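/- arXiv:2205.07375 — 3 statements merged into one kernel-verified Lean document; each statement's English description precedes it below -/
import Mathlib

section
/- Let r : ℝ^n → ℝ³ be differentiable at θ* with b := r(θ*) ≠ 0, let α ∈ (0, π/2), and define C(θ) := ‖r(θ) − b‖² ‖b‖² cos²(α) − ⟨r(θ) − b, b⟩². Assume there exists w ∈ ℝ^n such that the directional derivative Dr(θ*)w is nonzero and orthogonal to b (in particular this holds if the derivative Dr(θ*) : ℝ^n → ℝ³ is surjective). Then C(θ*) = 0, and there exists ε₀ > 0 such that for every ε ∈ (0, ε₀] the set C⁺ := {θ : C(θ) > 0} has nonempty intersection with the open ball B(θ*, ε). -/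
open Metric Set Filter Topology Real RealInnerProductSpace

/-- The candidate Chetaev function `C_twz` vanishes at the folded conformation `θ*`,
and its positivity set meets every sufficiently small ball around `θ*`. -/
theorem candidate_chetaev_function_properties {n : ℕ}
    (r : EuclideanSpace ℝ (Fin n) → EuclideanSpace ℝ (Fin 3))
    (θs : EuclideanSpace ℝ (Fin n)) (hr : DifferentiableAt ℝ r θs)
    (b : EuclideanSpace ℝ (Fin 3)) (hb : b = r θs) (hb0 : b ≠ 0)
    (α : ℝ) (hα : α ∈ Set.Ioo 0 (π / 2))
    (C : EuclideanSpace ℝ (Fin n) → ℝ)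
    (hC : ∀ θ, C θ = ‖r θ - b‖ ^ 2 * ‖b‖ ^ 2 * cos α ^ 2 - ⟪r θ - b, b⟫ ^ 2)
    (hw : ∃ w : EuclideanSpace ℝ (Fin n),
      fderiv ℝ r θs w ≠ 0 ∧ ⟪fderiv ℝ r θs w, b⟫ = 0) :
    C θs = 0 ∧ ∃ ε₀ > (0 : ℝ), ∀ ε ∈ Set.Ioc (0 : ℝ) ε₀,
      ({θ | 0 < C θ} ∩ Metric.ball θs ε).Nonempty := by
  obtain ⟨w, hw0, hwb⟩ := hw
  refine ⟨by rw [hC, ← hb]; simp, 1, one_pos, ?_⟩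
  intro ε hε
  set v := fderiv ℝ r θs w with hv
  have hslope : Tendsto (fun t : ℝ => t⁻¹ • (r (θs + t • w) - r θs)) (𝓝[≠] 0) (𝓝 v) :=
    (hr.hasFDerivAt.hasLineDerivAt w).tendsto_slope_zero
  have hcos : 0 < cos α := cos_pos_of_mem_Ioo ⟨by linarith [hα.1, pi_pos], hα.2⟩
  let F : EuclideanSpace ℝ (Fin 3) → ℝ :=
    fun x => ‖x‖ ^ 2 * ‖b‖ ^ 2 * cos α ^ 2 - ⟪x, b⟫ ^ 2
  have hF : Continuous F := by fun_prop
  have hFv : 0 < F v := by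
    have h1 : 0 < ‖v‖ := norm_pos_iff.2 hw0
    have h2 : 0 < ‖b‖ := norm_pos_iff.2 hb0
    simp only [F, hwb]
    have : 0 < ‖v‖ ^ 2 * ‖b‖ ^ 2 * cos α ^ 2 := by positivity
    linarith
  have e1 := ((hF.tendsto v).comp hslope).eventually (lt_mem_nhds hFv)
  have hcont : Continuous (fun t : ℝ => θs + t • w) := by fun_prop
  have e2 : ∀ᶠ t : ℝ in 𝓝[≠] 0, θs + t • w ∈ Metric.ball θs ε := by
    apply nhdsWithin_le_nhds
    apply hcont.continuousAt.eventually_mem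
    simpa using Metric.ball_mem_nhds θs hε.1
  obtain ⟨t, ht1, ht2⟩ := (e1.and e2).exists
  refine ⟨θs + t • w, ?_, ht2⟩
  have key : F (t⁻¹ • (r (θs + t • w) - r θs)) = (t⁻¹) ^ 2 * C (θs + t • w) := by
    rw [hC, ← hb]
    simp only [F, norm_smul, real_inner_smul_left, mul_pow, norm_eq_abs, sq_abs]
    ring
  have h3 : 0 < (t⁻¹) ^ 2 * C (θs + t • w) := by
    rw [← key]; exact ht1
  exact pos_of_mul_pos_right h3 (sq_nonneg _)
end

section
/- (Chetaev instability theorem.) Let f : ℝ^n → ℝ^n be locally Lipschitz with f(x*) = 0, and let C : ℝ^n → ℝ be continuously differentiable with C(x*) = 0. Suppose (i) for every ε > 0 there exists x with ‖x − x*‖ < ε and C(x) > 0, and (ii) there exists ρ > 0 such that ⟨∇C(x), f(x)⟩ > 0 for every x in the closed ball of radius ρ around x* with C(x) > 0. Then x* is an unstable equilibrium of ẋ = f(x); i.e., x* is not Lyapunov stable. -/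
open Metric Set Filter Topology RealInnerProductSpace

/-- A solution of `ẋ = g(x)` on an interval `I ⊆ ℝ` containing `0`. -/
def IsSolution {n : ℕ} (g : EuclideanSpace ℝ (Fin n) → EuclideanSpace ℝ (Fin n))
    (γ : ℝ → EuclideanSpace ℝ (Fin n)) (I : Set ℝ) : Prop :=
  (0 : ℝ) ∈ I ∧ I.OrdConnected ∧ ∀ t ∈ I, HasDerivWithinAt γ (g (γ t)) I t

/-- Lyapunov stability of `x₀` for `ẋ = g(x)`. -/
def LyapunovStable {n : ℕ} (g : EuclideanSpace ℝ (Fin n) → EuclideanSpace ℝ (Fin n))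
    (x₀ : EuclideanSpace ℝ (Fin n)) : Prop :=
  ∀ ε > 0, ∃ δ > 0, ∀ (γ : ℝ → EuclideanSpace ℝ (Fin n)) (I : Set ℝ),
    IsSolution g γ I → ‖γ 0 - x₀‖ < δ → ∀ t ∈ I, 0 ≤ t → ‖γ t - x₀‖ < ε

theorem exists_ball_retraction {n : ℕ} (xs : EuclideanSpace ℝ (Fin n)) (r : ℝ) (hr : 0 < r) :
    ∃ P : EuclideanSpace ℝ (Fin n) → EuclideanSpace ℝ (Fin n),
      (∀ x, P x ∈ Metric.closedBall xs r) ∧ (∀ x ∈ Metric.closedBall xs r, P x = x) ∧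
      LipschitzWith 1 P := by
  have hcv : Convex ℝ (Metric.closedBall xs r) := convex_closedBall xs r
  have h1 : ∀ u : EuclideanSpace ℝ (Fin n), ∃ v ∈ Metric.closedBall xs r,
      ∀ w ∈ Metric.closedBall xs r, ⟪u - v, w - v⟫ ≤ 0 := by
    intro u
    obtain ⟨v, hv, h⟩ := exists_norm_eq_iInf_of_complete_convex
      (K := Metric.closedBall xs r) ⟨xs, Metric.mem_closedBall_self hr.le⟩
      Metric.isClosed_closedBall.isComplete hcv u
    exact ⟨v, hv, (norm_eq_iInf_iff_real_inner_le_zero hcv hv).1 h⟩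
  choose P hP hin using h1
  refine ⟨P, hP, ?_, ?_⟩
  · intro x hx
    have h := hin x x hx
    rw [real_inner_self_eq_norm_sq] at h
    have h2 : ‖x - P x‖ = 0 := by
      have := norm_nonneg (x - P x)
      nlinarith
    exact (sub_eq_zero.1 (norm_eq_zero.1 h2)).symm
  · refine LipschitzWith.of_dist_le_mul fun x y => ?_
    rw [dist_eq_norm, dist_eq_norm, NNReal.coe_one, one_mul]
    have a := hin x (P y) (hP y)
    have b := hin y (P x) (hP x)
    have key : ‖P x - P y‖ ^ 2 ≤ ⟪x - y, P x - P y⟫ := by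
      rw [← real_inner_self_eq_norm_sq]
      have e : ⟪x - y, P x - P y⟫ - ⟪P x - P y, P x - P y⟫
          = - ⟪x - P x, P y - P x⟫ - ⟪y - P y, P x - P y⟫ := by
        simp only [inner_sub_left, inner_sub_right]
        ring
      linarith
    have cs := real_inner_le_norm (x - y) (P x - P y)
    by_contra hlt
    push Not at hlt
    have := norm_nonneg (x - y)
    nlinarith

theorem exists_global_solution {n : ℕ}
    (g : EuclideanSpace ℝ (Fin n) → EuclideanSpace ℝ (Fin n)) (K L : NNReal)
    (hg : LipschitzWith K g) (hL : ∀ x, ‖g x‖ ≤ L) (x : EuclideanSpace ℝ (Fin n))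
    (T : ℝ) (hT : 0 ≤ T) :
    ∃ γ : ℝ → EuclideanSpace ℝ (Fin n), γ 0 = x ∧
      ∀ t ∈ Icc 0 T, HasDerivWithinAt γ (g (γ t)) (Icc 0 T) t := by
  have hp : IsPicardLindelof (fun _ => g) (tmin := 0) (tmax := T) ⟨0, le_rfl, hT⟩ x
      (L * ⟨T, hT⟩) 0 L K := by
    refine IsPicardLindelof.of_time_independent (fun x _ => hL x) (hg.lipschitzOnWith) ?_
    simp only [sub_zero, sub_self, max_eq_left hT, NNReal.coe_zero, NNReal.coe_mul]
    exact le_rfl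
  exact hp.exists_eq_forall_mem_Icc_hasDerivWithinAt₀

/-- Chetaev's instability theorem: a `C¹` function `C` with `C(x*) = 0`, positive
arbitrarily close to `x*`, whose derivative along `f` is positive on the positivity set
of `C` near `x*`, certifies that `x*` is an unstable equilibrium of `ẋ = f(x)`. -/
theorem chetaev_instability {n : ℕ}
    (f : EuclideanSpace ℝ (Fin n) → EuclideanSpace ℝ (Fin n))
    (xs : EuclideanSpace ℝ (Fin n))
    (hf : LocallyLipschitz f) (hfxs : f xs = 0)
    (C : EuclideanSpace ℝ (Fin n) → ℝ)
    (hC : ContDiff ℝ 1 C) (hCxs : C xs = 0)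
    (hpos : ∀ ε > (0 : ℝ), ∃ x, ‖x - xs‖ < ε ∧ 0 < C x)
    (hder : ∃ ρ > (0 : ℝ), ∀ x ∈ Metric.closedBall xs ρ,
      0 < C x → 0 < ⟪gradient C x, f x⟫) :
    ¬ LyapunovStable f xs := by
  intro hst
  obtain ⟨ρ, hρ, hder⟩ := hder
  obtain ⟨K, s, hs, hK⟩ := hf xs
  obtain ⟨R, hR, hRs⟩ := Metric.nhds_basis_closedBall.mem_iff.1 hs
  obtain ⟨r, hr, hrρ, hrR⟩ : ∃ r > 0, r ≤ ρ ∧ r ≤ R :=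
    ⟨min ρ R, lt_min hρ hR, min_le_left _ _, min_le_right _ _⟩
  have hBρ := Metric.closedBall_subset_closedBall (x := xs) hrρ
  have hKr : LipschitzOnWith K f (Metric.closedBall xs r) :=
    hK.mono ((Metric.closedBall_subset_closedBall hrR).trans hRs)
  have hcomp : IsCompact (Metric.closedBall xs r) := isCompact_closedBall xs r
  have hfc : Continuous f := hf.continuous
  have hCc : Continuous C := hC.continuous
  obtain ⟨δ, hδ, hsol⟩ := hst r hr
  obtain ⟨x, hx, hcx⟩ := hpos (min δ r) (lt_min hδ hr)
  have hxδ := hx.trans_le (min_le_left _ _)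
  have hxr := hx.trans_le (min_le_right _ _)
  -- bounds
  obtain ⟨M, hM⟩ := hcomp.exists_bound_of_continuousOn hCc.continuousOn
  obtain ⟨L, hL⟩ := hcomp.exists_bound_of_continuousOn hfc.continuousOn
  have hφc : Continuous fun y => fderiv ℝ C y (f y) :=
    (hC.continuous_fderiv one_ne_zero).clm_apply hfc
  have hcomp2 : IsCompact (Metric.closedBall xs r ∩ {y | C x ≤ C y}) :=
    hcomp.inter_right (isClosed_le continuous_const hCc)
  have hxb : x ∈ Metric.closedBall xs r := by
    rw [mem_closedBall_iff_norm]; exact hxr.le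
  obtain ⟨z, ⟨hz1, hz2⟩, hzmin⟩ := hcomp2.exists_isMinOn ⟨x, hxb, le_refl (C x)⟩
    hφc.continuousOn
  obtain ⟨m, hm, hmle⟩ : ∃ m > 0, ∀ y ∈ Metric.closedBall xs r, C x ≤ C y →
      m ≤ fderiv ℝ C y (f y) := by
    refine ⟨fderiv ℝ C z (f z), ?_, fun y hy hy2 => hzmin ⟨hy, hy2⟩⟩
    have := hder z (hBρ hz1) (hcx.trans_le hz2)
    rwa [inner_gradient_left] at this
  obtain ⟨P, hP, hPid, hPl⟩ := exists_ball_retraction xs r hr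
  have hgl : LipschitzWith (K * 1) (f ∘ P) := by
    rw [← lipschitzOnWith_univ]
    exact hKr.comp hPl.lipschitzOnWith (fun y _ => hP y)
  obtain ⟨T, hT, hTM⟩ : ∃ T : ℝ, 0 ≤ T ∧ M < C x + m / 2 * T := by
    refine ⟨2 * |M| / m, by positivity, ?_⟩
    have : m / 2 * (2 * |M| / m) = |M| := by field_simp
    rw [this]
    linarith [le_abs_self M]
  obtain ⟨γ, hγ0, hγ⟩ := exists_global_solution (f ∘ P) (K * 1) L.toNNReal hgl
    (fun y => (hL _ (hP y)).trans (Real.le_coe_toNNReal L)) x T hT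
  have hγc : ContinuousOn γ (Icc 0 T) := HasDerivWithinAt.continuousOn hγ
  have hNc : ContinuousOn (fun t => ‖γ t - xs‖) (Icc 0 T) :=
    (hγc.sub continuousOn_const).norm
  have hN0 : ‖γ 0 - xs‖ < r := by rw [hγ0]; exact hxr
  have hstay : ∀ t ∈ Icc 0 T, ‖γ t - xs‖ < r := by
    by_contra! hcon
    obtain ⟨t, ht, htr⟩ := hcon
    have ivt : ∀ u ∈ Icc 0 T, r ≤ ‖γ u - xs‖ → ∃ v ∈ Icc 0 u, ‖γ v - xs‖ = r := by
      intro u hu hur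
      exact intermediate_value_Icc hu.1 (hNc.mono (Icc_subset_Icc_right hu.2)) ⟨hN0.le, hur⟩
    have hcS : IsCompact (Icc 0 T ∩ (fun t => ‖γ t - xs‖) ⁻¹' {r}) :=
      isCompact_Icc.of_isClosed_subset
        (hNc.preimage_isClosed_of_isClosed isClosed_Icc isClosed_singleton) inter_subset_left
    have hne : (Icc 0 T ∩ (fun t => ‖γ t - xs‖) ⁻¹' {r}).Nonempty := by
      obtain ⟨v, hv, hvr⟩ := ivt t ht htr
      exact ⟨v, ⟨hv.1, hv.2.trans ht.2⟩, hvr⟩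
    obtain ⟨t₁, ⟨ht₁, ht₁r⟩, hleast⟩ := hcS.exists_isLeast hne
    have ht₁r' : ‖γ t₁ - xs‖ = r := ht₁r
    have hin : ∀ u ∈ Icc 0 t₁, ‖γ u - xs‖ ≤ r := by
      intro u hu
      by_contra! hlt
      have huT : u ∈ Icc 0 T := ⟨hu.1, hu.2.trans ht₁.2⟩
      obtain ⟨v, hv, hvr⟩ := ivt u huT hlt.le
      have h1 : t₁ ≤ v := hleast ⟨⟨hv.1, hv.2.trans huT.2⟩, hvr⟩
      have h2 : u = t₁ := le_antisymm hu.2 (h1.trans hv.2)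
      rw [h2, ht₁r'] at hlt
      exact lt_irrefl _ hlt
    have := hsol γ (Icc 0 t₁) ⟨⟨le_rfl, ht₁.1⟩, ordConnected_Icc, fun u hu => by
      have h := (hγ u ⟨hu.1, hu.2.trans ht₁.2⟩).mono (Icc_subset_Icc_right ht₁.2)
      rwa [Function.comp_apply, hPid _ (mem_closedBall_iff_norm.2 (hin u hu))] at h⟩
      (by rw [hγ0]; exact hxδ) t₁ ⟨ht₁.1, le_rfl⟩ ht₁.1
    rw [ht₁r'] at this
    exact lt_irrefl _ this
  have hball : ∀ t ∈ Icc 0 T, γ t ∈ Metric.closedBall xs r := fun t ht =>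
    mem_closedBall_iff_norm.2 (hstay t ht).le
  have hfin := image_le_of_deriv_right_lt_deriv_boundary (a := 0) (b := T)
    (f := fun t => - C (γ t)) (f' := fun t => - fderiv ℝ C (γ t) (f (γ t)))
    (B := fun t => - (C x + m / 2 * t)) (B' := fun _ => - (m / 2))
    (hCc.comp_continuousOn hγc).neg
    (fun t ht => by
      have ht' : t ∈ Icc 0 T := ⟨ht.1, ht.2.le⟩
      have h := hγ t ht'
      rw [Function.comp_apply, hPid _ (hball t ht')] at h
      have h2 : HasDerivWithinAt γ (f (γ t)) (Ici t) t :=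
        h.mono_of_mem_nhdsWithin (mem_of_superset (Icc_mem_nhdsGE ht.2)
          (Icc_subset_Icc_left ht.1))
      exact ((hC.differentiable one_ne_zero (γ t)).hasFDerivAt.comp_hasDerivWithinAt t h2).neg)
    (by simp [hγ0])
    (fun t => by
      have := (((hasDerivAt_id t).const_mul (m / 2)).const_add (C x)).neg
      rw [mul_one] at this
      exact this)
    (fun t ht heq => by
      have ht' : t ∈ Icc 0 T := ⟨ht.1, ht.2.le⟩
      have h0 : 0 ≤ m / 2 * t := mul_nonneg (by linarith) ht.1
      have := hmle (γ t) (hball t ht') (by linarith)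
      linarith)
    (right_mem_Icc.2 hT)
  have hb := (le_abs_self _).trans (hM _ (hball T (right_mem_Icc.2 hT)))
  linarith
end

section
/- Let p, q ∈ ℝ with 2q ≥ p > 1 and q > 1, and for a ∈ ℝ and b > 0 define φ(a, b) := (a − (|a|^p + b^{2q})^{1/p}) / b². Let B ∈ ℝ^n with B ≠ 0 and v ∈ ℝ^n, set a := ⟨B, v⟩, and define the control input u := −φ(a, ‖B‖) B. Then ⟨B, v + u⟩ = (|a|^p + ‖B‖^{2q})^{1/p} > 0. -/
open Real RealInnerProductSpace

/-- The Artstein–Sontag-type universal formula for Chetaev control functions: with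
`a = ⟪B, v⟫` and `u = -φ(a, ‖B‖) • B`, the Chetaev derivative `⟪B, v + u⟫` equals
`(|a|^p + ‖B‖^(2q))^(1/p)` and is strictly positive. -/
theorem artstein_sontag_universal_formula {n : ℕ}
    (p q : ℝ) (hp : 1 < p) (hpq : p ≤ 2 * q) (hq : 1 < q)
    (φ : ℝ → ℝ → ℝ)
    (hφ : ∀ a : ℝ, ∀ s : ℝ, 0 < s →
      φ a s = (a - (|a| ^ p + s ^ (2 * q)) ^ (1 / p)) / s ^ 2)
    (B v : EuclideanSpace ℝ (Fin n)) (hB : B ≠ 0)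
    (a : ℝ) (ha : a = ⟪B, v⟫)
    (u : EuclideanSpace ℝ (Fin n)) (hu : u = (-(φ a ‖B‖)) • B) :
    ⟪B, v + u⟫ = (|a| ^ p + ‖B‖ ^ (2 * q)) ^ (1 / p) ∧
      0 < (|a| ^ p + ‖B‖ ^ (2 * q)) ^ (1 / p) := by
  have hs : 0 < ‖B‖ := norm_pos_iff.mpr hB
  constructor
  · rw [hu, inner_add_right, inner_smul_right, real_inner_self_eq_norm_sq, ← ha, hφ a _ hs,
      neg_mul, div_mul_cancel₀ _ (pow_ne_zero 2 hs.ne')]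
    ring
  · have h1 : 0 ≤ |a| ^ p := Real.rpow_nonneg (abs_nonneg a) p
    have h2 : 0 < ‖B‖ ^ (2 * q) := Real.rpow_pos_of_pos hs _
    exact Real.rpow_pos_of_pos (by linarith) _
end
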